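/- Raviolo Goddard uniqueness theorem (Proposition 3.1): Let 𝒱 be a raviolo vertex algebra and let A(z) be a homogeneous raviolo field on 𝒱 that is mutually local with Y(b,z) for every b ∈ 𝒱. If there exists a ∈ 𝒱 with A(z)|0⟩ = Y(a,z)|0⟩, then A(z) = Y(a,z). -/

import Mathlib

noncomputable section

variable {V : Type} [AddCommGroup V] [Module ℂ V]

/-- Indicator of `0 ≤ m`, as an integer (the cohomological degree of the monomial of
index `m`: `z`-powers are of degree `0`, the `Ω^m` of degree `1`). -/
def indZ (m : ℤ) : ℤ := if 0 ≤ m then 1 else 0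

def sgnZ (m : ℤ) : ℂ := if 0 ≤ m then 1 else -1

/-- The generalized binomial coefficient `C(m, n) = m (m−1) ⋯ (m−n+1) / n!`. -/
def genBinom (m : ℤ) (n : ℕ) : ℂ :=
  (∏ i ∈ Finset.range n, ((m : ℂ) - (i : ℂ))) / (n.factorial : ℂ)

/-- Validity of combining monomial indices `a`, `b` in one variable: the product of the
corresponding monomials is the monomial of index `a + b + 1` when `okIdx a b` holds, and is
zero otherwise. -/
def okIdx (a b : ℤ) : Prop := (a < 0 ∧ b < 0) ∨ (¬(0 ≤ a ∧ 0 ≤ b) ∧ 0 ≤ a + b + 1)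

instance (a b : ℤ) : Decidable (okIdx a b) := by unfold okIdx; infer_instance

/-- A raviolo field on `V`: a family of modes `A m` (`m < 0` the coefficient of `z^{−m−1}`,
`m ≥ 0` the coefficient of `Ω^m_z`) acting finitely on every vector. -/
def IsRavField (A : ℤ → V →ₗ[ℂ] V) : Prop := ∀ v : V, ∃ N : ℤ, ∀ m : ℤ, N ≤ m → A m v = 0

/-- Homogeneity of a raviolo field of cohomological degree `d` with respect to a grading:
the mode `A m` has degree `d` for `m < 0` and degree `d − 1` for `m ≥ 0`. -/
def IsHomog (gr : ℤ → Submodule ℂ V) (d : ℤ) (A : ℤ → V →ₗ[ℂ] V) : Prop :=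
  ∀ (m r : ℤ) (v : V), v ∈ gr r → A m v ∈ gr (r + d + if 0 ≤ m then -1 else 0)

/-- The coefficient of `(1/n!) ∂ⁿ_w Δ(z−w) Cⁿ(w)` at the basis monomial of biindex `(m, k)`
(the mode of `Cⁿ` appearing there is `Cⁿ (k − n + m)`). -/
def deltaCoef (m : ℤ) (n : ℕ) (k : ℤ) : ℂ :=
  if okIdx ((n : ℤ) - m - 1) (k - (n : ℤ) + m) then sgnZ m * genBinom m n else 0

/-- The identity `[A(z), B(w)] = ∑_{n=0}^{N} (1/n!) ∂ⁿ_w Δ(z−w) Cⁿ(w)` in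
`End(V) ⊗ 𝒦^{z,w}_dist`, written out in coefficients (with the Koszul signs coming from
moving modes past monomials). -/
def CommEq (dA dB : ℤ) (A B : ℤ → V →ₗ[ℂ] V) (N : ℕ) (C : ℕ → ℤ → V →ₗ[ℂ] V) : Prop :=
  ∀ (m k : ℤ) (v : V),
    ((-1 : ℂ) ^ ((dA + indZ m) * indZ k)) • A m (B k v)
      - ((-1 : ℂ) ^ (dA * dB + indZ m * dB)) • B k (A m v)
    = ∑ n ∈ Finset.range (N + 1), deltaCoef m n k • C n (k - (n : ℤ) + m) v

/-- Mutual locality of two homogeneous raviolo fields of degrees `dA`, `dB`: there are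
finitely many homogeneous fields `C⁰, …, C^N` with
`[A(z), B(w)] = ∑ₙ (1/n!) ∂ⁿ_w Δ(z−w) Cⁿ(w)`. -/
def MutLocal (gr : ℤ → Submodule ℂ V) (dA dB : ℤ) (A B : ℤ → V →ₗ[ℂ] V) : Prop :=
  ∃ (N : ℕ) (C : ℕ → ℤ → V →ₗ[ℂ] V) (dC : ℕ → ℤ),
    (∀ n, IsRavField (C n)) ∧ (∀ n, IsHomog gr (dC n) (C n)) ∧ CommEq dA dB A B N C

/-- A raviolo vertex algebra structure on the graded vector space `V` (with grading `gr`),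
with vacuum vector `vac`, translation operator `T`, and state-operator correspondence
`Y : a ↦ (a₍ₘ₎)ₘ`:  the state-field axiom, the translation axiom
`[∂, Y(a,z)] = ∂_z Y(a,z)`, the vacuum axiom, and the locality axiom. -/
def IsRVA (gr : ℤ → Submodule ℂ V) (vac : V) (T : V →ₗ[ℂ] V)
    (Y : V → ℤ → V →ₗ[ℂ] V) : Prop :=
  DirectSum.IsInternal gr ∧
  vac ∈ gr 0 ∧
  (∀ (a b : V) (m : ℤ), Y (a + b) m = Y a m + Y b m) ∧
  (∀ (c : ℂ) (a : V) (m : ℤ), Y (c • a) m = c • Y a m) ∧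
  (∀ a : V, IsRavField (Y a)) ∧
  (∀ (d : ℤ) (a : V), a ∈ gr d → IsHomog gr d (Y a)) ∧
  (∀ (d : ℤ) (a : V), a ∈ gr d → T a ∈ gr d) ∧
  (∀ (a v : V) (m : ℤ), T (Y a m v) - Y a m (T v) = (-(m : ℂ)) • Y a (m - 1) v) ∧
  T vac = 0 ∧
  (∀ (m : ℤ) (v : V), Y vac m v = if m = -1 then v else 0) ∧
  (∀ (a : V) (m : ℤ), 0 ≤ m → Y a m vac = 0) ∧
  (∀ a : V, Y a (-1) vac = a) ∧
  (∀ (dA dB : ℤ) (a b : V), a ∈ gr dA → b ∈ gr dB → MutLocal gr dA dB (Y a) (Y b))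

lemma genBinom_zero_right (m : ℤ) : genBinom m 0 = 1 := by simp [genBinom]

lemma genBinom_pascal (m : ℤ) (n : ℕ) :
    genBinom m (n + 1) - genBinom (m - 1) (n + 1) = genBinom (m - 1) n := by
  unfold genBinom
  have h1 : ∏ i ∈ Finset.range (n + 1), ((m : ℂ) - (i : ℂ))
      = (m : ℂ) * ∏ i ∈ Finset.range n, (((m - 1 : ℤ) : ℂ) - (i : ℂ)) := by
    rw [Finset.prod_range_succ', mul_comm]
    congr 1
    · simp
    · refine Finset.prod_congr rfl fun i _ => ?_
      push_cast
      ring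
  rw [h1, Finset.prod_range_succ, Nat.factorial_succ]
  have hn : ((n : ℂ) + 1) ≠ 0 := by exact_mod_cast Nat.succ_ne_zero n
  have hf : (n.factorial : ℂ) ≠ 0 := by exact_mod_cast Nat.factorial_ne_zero n
  push_cast
  field_simp
  ring

lemma genBinom_indep {V : Type} [AddCommGroup V] [Module ℂ V] (M : ℕ) :
    ∀ (b : ℤ) (x : ℕ → V), (∀ m : ℤ, m < b → ∑ n ∈ Finset.range M, genBinom m n • x n = 0) →
      ∀ n < M, x n = 0 := by
  induction M with
  | zero => intro b x _ n hn; omega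
  | succ M ih =>
    intro b x h
    have hs : ∀ n < M, x (n + 1) = 0 := by
      refine ih (b - 1) (fun n => x (n + 1)) ?_
      intro m hm
      · have e1 := h (m + 1) (by omega)
        have e2 := h m (by omega)
        rw [Finset.sum_range_succ'] at e1 e2
        rw [genBinom_zero_right] at e1 e2
        have e3 : ∑ n ∈ Finset.range M, genBinom (m + 1) (n + 1) • x (n + 1)
            - ∑ n ∈ Finset.range M, genBinom m (n + 1) • x (n + 1) = 0 := by
          rw [eq_neg_of_add_eq_zero_left e1, eq_neg_of_add_eq_zero_left e2, sub_self]
        rw [← Finset.sum_sub_distrib] at e3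
        rw [← e3]
        refine Finset.sum_congr rfl fun n _ => ?_
        rw [← sub_smul]
        congr 1
        have := genBinom_pascal (m + 1) n
        rw [add_sub_cancel_right] at this
        exact this.symm
    have h0 : x 0 = 0 := by
      have e1 := h (b - 1) (by omega)
      rw [Finset.sum_range_succ', genBinom_zero_right, one_smul,
        Finset.sum_eq_zero, zero_add] at e1
      · exact e1
      · intro n hn
        rw [hs n (Finset.mem_range.1 hn), smul_zero]
    intro n hn
    rcases n with _ | n
    · exact h0
    · exact hs n (by omega)

lemma commEq_sub {V : Type} [AddCommGroup V] [Module ℂ V] {dA dB : ℤ}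
    {A A₂ B : ℤ → V →ₗ[ℂ] V} {N N₂ : ℕ} {C C₂ : ℕ → ℤ → V →ₗ[ℂ] V}
    (h : CommEq dA dB A B N C) (h₂ : CommEq dA dB A₂ B N₂ C₂) :
    CommEq dA dB (fun m => A m - A₂ m) B (max N N₂)
      (fun n j => (if n ≤ N then C n j else 0) - (if n ≤ N₂ then C₂ n j else 0)) := by
  have aux : ∀ (P Q : ℕ) (f : ℕ → V), P ≤ Q →
      ∑ n ∈ Finset.range (P + 1), f n
        = ∑ n ∈ Finset.range (Q + 1), if n ≤ P then f n else 0 := by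
    intro P Q f hPQ
    rw [← Finset.sum_filter]
    refine Finset.sum_congr ?_ fun _ _ => rfl
    ext n
    simp only [Finset.mem_range, Finset.mem_filter]
    omega
  intro m k v
  have e := h m k v
  have e₂ := h₂ m k v
  rw [aux N (max N N₂) _ (le_max_left _ _)] at e
  rw [aux N₂ (max N N₂) _ (le_max_right _ _)] at e₂
  have e2 := congrArg₂ (· - ·) e e₂
  beta_reduce at e2
  rw [← Finset.sum_sub_distrib] at e2
  refine Eq.trans ?_ (e2.trans ?_)
  · simp only [LinearMap.sub_apply, map_sub, smul_sub]
    abel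
  · refine Finset.sum_congr rfl fun n _ => ?_
    by_cases h1 : n ≤ N <;> by_cases h2 : n ≤ N₂ <;> simp [h1, h2, smul_sub]

lemma commEq_vac {V : Type} [AddCommGroup V] [Module ℂ V] {dA dB : ℤ}
    {D B : ℤ → V →ₗ[ℂ] V} {N : ℕ} {C : ℕ → ℤ → V →ₗ[ℂ] V}
    (h : CommEq dA dB D B N C) (vac : V) (hD : ∀ m, D m vac = 0)
    (hB : ∀ m, 0 ≤ m → B m vac = 0) (m : ℤ) : D m (B (-1) vac) = 0 := by
  -- the coefficients `C^j_{-1}|0⟩` vanish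
  have hC : ∀ j : ℕ, j < N + 1 → C j (-1) vac = 0 := by
    intro j hj
    have key := genBinom_indep (N + 1) 0
      (fun n => if j ≤ n then C n ((j : ℤ) - 1 - n) vac else 0) (by
        intro m hm
        have e := h m ((j : ℤ) - 1 - m) vac
        rw [hD m, hB _ (by omega), map_zero, map_zero, smul_zero, smul_zero, sub_zero] at e
        refine neg_eq_zero.1 (Eq.trans ?_ e.symm)
        rw [← Finset.sum_neg_distrib]
        refine Finset.sum_congr rfl fun n _ => ?_
        have hi : (j : ℤ) - 1 - m - n + m = (j : ℤ) - 1 - n := by ring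
        rw [hi]
        by_cases hn : j ≤ n
        · have hok : okIdx ((n : ℤ) - m - 1) ((j : ℤ) - 1 - m - n + m) := by
            unfold okIdx; omega
          simp [deltaCoef, hok, hn, sgnZ, not_le.2 hm]
        · have hok : ¬ okIdx ((n : ℤ) - m - 1) ((j : ℤ) - 1 - m - n + m) := by
            unfold okIdx; omega
          simp [deltaCoef, hok, hn]) j hj
    simpa using key
  have e := h m (-1) vac
  rw [hD m, map_zero, smul_zero, sub_zero] at e
  have hs : ((-1 : ℂ) ^ ((dA + indZ m) * indZ (-1))) = 1 := by simp [indZ]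
  rw [hs, one_smul] at e
  rw [e]
  refine Finset.sum_eq_zero fun n hn => ?_
  by_cases hnm : (n : ℤ) = m
  · have hi : (-1 : ℤ) - n + m = -1 := by omega
    rw [hi, hC n (Finset.mem_range.1 hn), smul_zero]
  · have hok : ¬ okIdx ((n : ℤ) - m - 1) (-1 - n + m) := by
      unfold okIdx; omega
    simp [deltaCoef, hok]

/-- Raviolo Goddard uniqueness theorem (Proposition 3.1): if a homogeneous raviolo field
`A(z)` on a raviolo vertex algebra is mutually local with all fields `Y(b,z)` and agrees
with `Y(a,z)` on the vacuum, then `A(z) = Y(a,z)`. -/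
theorem raviolo_goddard_uniqueness
    (V : Type) [AddCommGroup V] [Module ℂ V]
    (gr : ℤ → Submodule ℂ V) (vac : V) (T : V →ₗ[ℂ] V) (Y : V → ℤ → V →ₗ[ℂ] V)
    (hV : IsRVA gr vac T Y)
    (dA : ℤ) (A : ℤ → V →ₗ[ℂ] V) (hAf : IsRavField A) (hAh : IsHomog gr dA A)
    (hloc : ∀ (d : ℤ) (b : V), b ∈ gr d → MutLocal gr dA d A (Y b))
    (a : V) (hvac : ∀ m : ℤ, A m vac = Y a m vac) :
    ∀ m : ℤ, A m = Y a m := by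
  obtain ⟨hInt, hv0, -, -, -, hYh, -, -, -, -, hYpos, hYvac, hYloc⟩ := hV
  have ha : a ∈ gr dA := by
    have := hAh (-1) 0 vac hv0
    rw [hvac, hYvac] at this
    simpa using this
  intro m
  ext v
  have hv : v ∈ ⨆ i, gr i := by
    rw [hInt.submodule_iSup_eq_top]
    exact Submodule.mem_top
  induction hv using Submodule.iSup_induction' with
  | mem d b hb =>
    obtain ⟨N, C, _, _, _, h⟩ := hloc d b hb
    obtain ⟨N₂, C₂, _, _, _, h₂⟩ := hYloc dA d a b ha hb
    have := commEq_vac (commEq_sub h h₂) vac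
      (fun m => by rw [LinearMap.sub_apply, hvac, sub_self]) (hYpos b) m
    rw [hYvac, LinearMap.sub_apply] at this
    exact sub_eq_zero.1 this
  | zero => simp
  | add x y _ _ hx hy => rw [map_add, map_add, hx, hy]
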